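/- arXiv:1810.01173 — 8 statements merged into one kernel-verified Lean document; each statement's English description precedes it below -/
import Mathlib

section
/- Let X, C : ℝ → ℝ be differentiable functions satisfying, for all t, X'(t) = C(t) and C'(t) = (a'·sin(2πX(t)) + ω − C(t))/τ_p, where a', ω ∈ ℝ and τ_p > 0. Set C_max = |a'| + |ω| + 1. If at some time t* we have C(t*) > C_max, and C(t) ≥ C_max for all t ∈ [t*, t*+δ] with δ ≥ 0, then δ ≤ (C(t*) − C_max)·τ_p. In particular, the velocity C falls below C_max in finite time. -/
open Real

/-- Relaxation estimate: if the velocity of the reduced 1D particle system stays above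
`C_max = |a'| + |ω| + 1` on `[t*, t* + δ]` and starts above it, then
`δ ≤ (C(t*) − C_max)·τ_p`; in particular the velocity falls below `C_max` in finite time. -/
theorem stmt_0 (X C : ℝ → ℝ) (a' ω τp : ℝ) (hτ : 0 < τp)
    (hX : ∀ t, HasDerivAt X (C t) t)
    (hC : ∀ t, HasDerivAt C ((a' * Real.sin (2 * Real.pi * X t) + ω - C t) / τp) t)
    (Cmax : ℝ) (hCmax : Cmax = |a'| + |ω| + 1)
    (tstar δ : ℝ) (hδ : 0 ≤ δ)
    (hstart : C tstar > Cmax)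
    (habove : ∀ t ∈ Set.Icc tstar (tstar + δ), C t ≥ Cmax) :
    δ ≤ (C tstar - Cmax) * τp := by
  rcases hδ.eq_or_lt with h0 | h0
  · rw [← h0]
    exact mul_nonneg (by linarith) hτ.le
  · obtain ⟨c, hc, hcd⟩ := exists_hasDerivAt_eq_slope C
      (fun t => (a' * Real.sin (2 * Real.pi * X t) + ω - C t) / τp)
      (show tstar < tstar + δ by linarith)
      (fun t _ => (hC t).continuousAt.continuousWithinAt) (fun t _ => hC t)
    have h1 := habove c ⟨hc.1.le, hc.2.le⟩
    have h2 := habove (tstar + δ) ⟨by linarith, le_refl _⟩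
    have h3 : a' * Real.sin (2 * Real.pi * X c) ≤ |a'| := by
      refine (le_abs_self _).trans ?_
      rw [abs_mul]
      exact mul_le_of_le_one_right (abs_nonneg _) (Real.abs_sin_le_one _)
    have h4 := le_abs_self ω
    rw [add_sub_cancel_left, div_eq_div_iff hτ.ne' h0.ne'] at hcd
    have h5 : (a' * Real.sin (2 * Real.pi * X c) + ω - C c) * δ ≤ (-1) * δ :=
      mul_le_mul_of_nonneg_right (by linarith) hδ
    have h6 : Cmax * τp ≤ C (tstar + δ) * τp := mul_le_mul_of_nonneg_right h2 hτ.le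
    linarith
end

section
/- Let X, C : ℝ → ℝ be differentiable functions satisfying, for all t, X'(t) = C(t) and C'(t) = (a'·sin(2πX(t)) + ω − C(t))/τ_p, where a', ω ∈ ℝ and τ_p > 0. Set C_max = |a'| + |ω| + 1. If at some time t* we have C(t*) < −C_max, and C(t) ≤ −C_max for all t ∈ [t*, t*+δ] with δ ≥ 0, then δ ≤ (−C_max − C(t*))·τ_p. In particular, the velocity C rises above −C_max in finite time. -/
open Real

/-- Symmetric relaxation estimate: if the velocity of the reduced 1D particle system stays
below `−C_max` (with `C_max = |a'| + |ω| + 1`) on `[t*, t* + δ]` and starts below it, then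
`δ ≤ (−C_max − C(t*))·τ_p`; in particular the velocity rises above `−C_max` in finite time. -/
theorem stmt_1 (X C : ℝ → ℝ) (a' ω τp : ℝ) (hτ : 0 < τp)
    (hX : ∀ t, HasDerivAt X (C t) t)
    (hC : ∀ t, HasDerivAt C ((a' * Real.sin (2 * Real.pi * X t) + ω - C t) / τp) t)
    (Cmax : ℝ) (hCmax : Cmax = |a'| + |ω| + 1)
    (tstar δ : ℝ) (hδ : 0 ≤ δ)
    (hstart : C tstar < -Cmax)
    (hbelow : ∀ t ∈ Set.Icc tstar (tstar + δ), C t ≤ -Cmax) :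
    δ ≤ (-Cmax - C tstar) * τp := by
  rcases hδ.eq_or_lt with h0 | hpos
  · rw [← h0]
    exact mul_nonneg (by linarith) hτ.le
  · obtain ⟨c, hc, hs⟩ := exists_hasDerivAt_eq_slope C _ (by linarith : tstar < tstar + δ)
      (fun t _ => (hC t).continuousAt.continuousWithinAt) (fun t _ => hC t)
    have h1 := hbelow c ⟨hc.1.le, hc.2.le⟩
    have h2 := hbelow (tstar + δ) ⟨by linarith, le_rfl⟩
    have h3 : |a' * Real.sin (2 * Real.pi * X c)| ≤ |a'| := by
      rw [abs_mul]
      exact mul_le_of_le_one_right (abs_nonneg _) (Real.abs_sin_le_one _)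
    have h4 := neg_abs_le (a' * Real.sin (2 * Real.pi * X c))
    have h5 := neg_abs_le ω
    have h6 : 1 ≤ a' * Real.sin (2 * Real.pi * X c) + ω - C c := by linarith
    rw [add_sub_cancel_left, div_eq_div_iff hτ.ne' hpos.ne'] at hs
    have h7 := mul_le_mul_of_nonneg_right h6 hδ
    have h8 := mul_le_mul_of_nonneg_right (sub_le_sub_right h2 (C tstar)) hτ.le
    linarith
end

section
/- Let X, C : ℝ → ℝ be differentiable functions satisfying, for all t, X'(t) = C(t) and C'(t) = (a'·sin(2πX(t)) + ω − C(t))/τ_p, where a', ω ∈ ℝ and τ_p > 0. If at some time t₀ the velocity satisfies C(t₀) ∈ [ω − |a'|, ω + |a'|], then C(t) ∈ [ω − |a'|, ω + |a'|] for all t ≥ t₀; that is, the closed interval [ω − |a'|, ω + |a'|] is forward invariant for the velocity. -/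
open Real

/-- Forward invariance of the interval `[ω − |a'|, ω + |a'|]` for the velocity of the
reduced 1D particle system. -/
theorem stmt_2 (X C : ℝ → ℝ) (a' ω τp : ℝ) (hτ : 0 < τp)
    (hX : ∀ t, HasDerivAt X (C t) t)
    (hC : ∀ t, HasDerivAt C ((a' * Real.sin (2 * Real.pi * X t) + ω - C t) / τp) t)
    (t₀ : ℝ) (h₀ : C t₀ ∈ Set.Icc (ω - |a'|) (ω + |a'|)) :
    ∀ t, t₀ ≤ t → C t ∈ Set.Icc (ω - |a'|) (ω + |a'|) := by
  intro t ht
  have hb : ∀ s, |a' * Real.sin (2 * Real.pi * X s)| ≤ |a'| := fun s => by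
    rw [abs_mul]
    exact mul_le_of_le_one_right (abs_nonneg _) (Real.abs_sin_le_one _)
  have hd : ∀ K s, HasDerivAt (fun s => Real.exp (s / τp) * (C s - K))
      (Real.exp (s / τp) / τp * (a' * Real.sin (2 * Real.pi * X s) + ω - K)) s := fun K s => by
    have h := (((hasDerivAt_id s).div_const τp).exp).mul ((hC s).sub_const K)
    refine h.congr_deriv ?_
    simp only [id]
    field_simp
    ring
  have hpos : ∀ s, 0 ≤ Real.exp (s / τp) / τp := fun s => by positivity
  constructor
  · have hm : Monotone (fun s => Real.exp (s / τp) * (C s - (ω - |a'|))) :=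
      monotone_of_hasDerivAt_nonneg (fun s => hd _ s) (fun s =>
        mul_nonneg (hpos s) (by linarith [(abs_le.mp (hb s)).1]))
    have h1 : 0 ≤ Real.exp (t₀ / τp) * (C t₀ - (ω - |a'|)) :=
      mul_nonneg (Real.exp_pos _).le (by linarith [h₀.1])
    have h2 : 0 ≤ Real.exp (t / τp) * (C t - (ω - |a'|)) := h1.trans (hm ht)
    linarith [nonneg_of_mul_nonneg_right h2 (Real.exp_pos _)]
  · have hm : Antitone (fun s => Real.exp (s / τp) * (C s - (ω + |a'|))) :=
      antitone_of_hasDerivAt_nonpos (fun s => hd _ s) (fun s =>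
        mul_nonpos_of_nonneg_of_nonpos (hpos s) (by linarith [(abs_le.mp (hb s)).2]))
    have h1 : Real.exp (t₀ / τp) * (C t₀ - (ω + |a'|)) ≤ 0 :=
      mul_nonpos_of_nonneg_of_nonpos (Real.exp_pos _).le (by linarith [h₀.2])
    have h2 : Real.exp (t / τp) * (C t - (ω + |a'|)) ≤ 0 := (hm ht).trans h1
    by_contra hn
    have : 0 < Real.exp (t / τp) * (C t - (ω + |a'|)) :=
      mul_pos (Real.exp_pos _) (by linarith [not_le.mp hn])
    linarith
end

section
/- Let X, C : ℝ → ℝ be differentiable functions satisfying, for all t, X'(t) = C(t) and C'(t) = (a'·sin(2πX(t)) + ω − C(t))/τ_p, where a', ω ∈ ℝ and τ_p > 0. Then for every ε > 0 there exists a time T such that for all t ≥ T one has ω − |a'| − ε ≤ C(t) ≤ ω + |a'| + ε; that is, after a transitory time the velocity remains in an arbitrarily small enlargement of the interval [ω − |a'|, ω + |a'|]. -/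
open Real

theorem relax_aux (f g : ℝ → ℝ) (M τ : ℝ) (hτ : 0 < τ)
    (hf : ∀ t, HasDerivAt f ((g t - f t) / τ) t) (hg : ∀ t, g t ≤ M) :
    ∀ ε > 0, ∃ T : ℝ, ∀ t, T ≤ t → f t ≤ M + ε := by
  intro ε hε
  have hd : ∀ t, HasDerivAt (fun t => Real.exp (t / τ) * (f t - M))
      (Real.exp (t / τ) * (1 / τ) * (f t - M) + Real.exp (t / τ) * ((g t - f t) / τ)) t := by
    intro t
    exact (((hasDerivAt_id t).div_const τ).exp).mul ((hf t).sub_const M)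
  have hanti : Antitone (fun t => Real.exp (t / τ) * (f t - M)) := by
    refine antitone_of_deriv_nonpos (fun t => (hd t).differentiableAt) (fun t => ?_)
    rw [(hd t).deriv]
    have e : Real.exp (t / τ) * (1 / τ) * (f t - M) + Real.exp (t / τ) * ((g t - f t) / τ)
        = Real.exp (t / τ) / τ * (g t - M) := by
      field_simp
      ring
    rw [e]
    exact mul_nonpos_of_nonneg_of_nonpos (by positivity) (by linarith [hg t])
  refine ⟨τ * (|f 0 - M| / ε), fun t ht => ?_⟩
  have h0 : 0 ≤ t := le_trans (by positivity) ht
  have h1 := hanti h0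
  simp only [zero_div, Real.exp_zero, one_mul] at h1
  have h2 : |f 0 - M| / ε ≤ t / τ := by
    rw [le_div_iff₀ hτ]
    linarith
  have h3 : |f 0 - M| / ε ≤ Real.exp (t / τ) := by
    linarith [Real.add_one_le_exp (t / τ)]
  rw [div_le_iff₀ hε] at h3
  have h4 : Real.exp (t / τ) * (f t - M) ≤ Real.exp (t / τ) * ε := by
    linarith [le_abs_self (f 0 - M)]
  have h5 := le_of_mul_le_mul_left h4 (Real.exp_pos _)
  linarith

/-- After a transitory time, the velocity of the reduced 1D particle system remains in an
arbitrarily small enlargement of the interval `[ω − |a'|, ω + |a'|]`. -/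
theorem stmt_3 (X C : ℝ → ℝ) (a' ω τp : ℝ) (hτ : 0 < τp)
    (hX : ∀ t, HasDerivAt X (C t) t)
    (hC : ∀ t, HasDerivAt C ((a' * Real.sin (2 * Real.pi * X t) + ω - C t) / τp) t) :
    ∀ ε > 0, ∃ T : ℝ, ∀ t, T ≤ t →
      ω - |a'| - ε ≤ C t ∧ C t ≤ ω + |a'| + ε := by
  intro ε hε
  have hb : ∀ t, |a' * Real.sin (2 * Real.pi * X t)| ≤ |a'| := by
    intro t
    rw [abs_mul]
    exact mul_le_of_le_one_right (abs_nonneg _) (Real.abs_sin_le_one _)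
  obtain ⟨T₁, h₁⟩ := relax_aux C (fun t => a' * Real.sin (2 * Real.pi * X t) + ω)
    (ω + |a'|) τp hτ hC (fun t => by linarith [(abs_le.mp (hb t)).2]) ε hε
  obtain ⟨T₂, h₂⟩ := relax_aux (fun t => -C t)
    (fun t => -(a' * Real.sin (2 * Real.pi * X t) + ω)) (-(ω - |a'|)) τp hτ
    (fun t => by
      have h := (hC t).neg
      refine HasDerivAt.congr_deriv (f := fun t => -C t) h ?_
      ring)
    (fun t => by linarith [(abs_le.mp (hb t)).1]) ε hε
  refine ⟨max T₁ T₂, fun t ht => ⟨?_, h₁ t (le_trans (le_max_left _ _) ht)⟩⟩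
  have := h₂ t (le_trans (le_max_right _ _) ht)
  linarith
end

section
/- Let X, C : ℝ → ℝ be differentiable functions satisfying, for all t, X'(t) = C(t) and C'(t) = (a'·sin(2πX(t)) + ω − C(t))/τ_p, where a', ω ∈ ℝ and τ_p > 0. If ω > |a'|, then there exists a time T such that for all t ≥ T one has C(t) ≥ (ω − |a'|)/2 > 0 and X(t) ≥ X(T) + ((ω − |a'|)/2)·(t − T). In particular X(t) → +∞ as t → +∞, so the trajectory is unbounded. -/
open Real Filter

/-- If `ω > |a'|`, the velocity of the reduced 1D particle system eventually stays above
`(ω − |a'|)/2 > 0`, hence the position grows at least linearly and `X(t) → +∞`: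
the trajectory is unbounded. -/
theorem stmt_4 (X C : ℝ → ℝ) (a' ω τp : ℝ) (hτ : 0 < τp)
    (hX : ∀ t, HasDerivAt X (C t) t)
    (hC : ∀ t, HasDerivAt C ((a' * Real.sin (2 * Real.pi * X t) + ω - C t) / τp) t)
    (hω : |a'| < ω) :
    (∃ T : ℝ, ∀ t, T ≤ t →
        (ω - |a'|) / 2 ≤ C t ∧ 0 < (ω - |a'|) / 2 ∧
        X T + (ω - |a'|) / 2 * (t - T) ≤ X t) ∧
      Tendsto X atTop atTop := by
  obtain ⟨m, hm⟩ : ∃ m, m = ω - |a'| := ⟨_, rfl⟩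
  rw [← hm]
  have hmpos : 0 < m := by linarith
  have hsin : ∀ t, m ≤ a' * Real.sin (2 * Real.pi * X t) + ω := by
    intro t
    have h1 : |a' * Real.sin (2 * Real.pi * X t)| ≤ |a'| := by
      rw [abs_mul]
      exact mul_le_of_le_one_right (abs_nonneg _) (Real.abs_sin_le_one _)
    have h2 := neg_abs_le (a' * Real.sin (2 * Real.pi * X t))
    linarith
  have hg : ∀ t, HasDerivAt (fun t => (C t - m) * Real.exp (t / τp))
      ((a' * Real.sin (2 * Real.pi * X t) + ω - m) / τp * Real.exp (t / τp)) t := by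
    intro t
    have h1 := ((hC t).sub_const m).mul (((hasDerivAt_id t).div_const τp).exp)
    refine h1.congr_deriv ?_
    simp only [id]
    field_simp
    ring
  have hmono : Monotone (fun t => (C t - m) * Real.exp (t / τp)) := by
    refine monotone_of_deriv_nonneg (fun t => (hg t).differentiableAt) (fun t => ?_)
    rw [(hg t).deriv]
    have := hsin t
    exact mul_nonneg (div_nonneg (by linarith) hτ.le) (Real.exp_pos _).le
  have hlim : Tendsto (fun t : ℝ => m / 2 * Real.exp (t / τp)) atTop atTop :=
    (Real.tendsto_exp_atTop.comp (tendsto_id.atTop_div_const hτ)).const_mul_atTop (by linarith)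
  obtain ⟨T₀, hT₀⟩ := eventually_atTop.1 (hlim.eventually_ge_atTop (m - C 0))
  have hCb : ∀ t, max T₀ 0 ≤ t → m / 2 ≤ C t := by
    intro t ht
    have h1 := hT₀ t (le_trans (le_max_left _ _) ht)
    have h2 := hmono (le_trans (le_max_right _ _) ht)
    simp only [zero_div, Real.exp_zero, mul_one] at h2
    by_contra! h3
    have h4 := mul_pos (sub_pos.2 h3) (Real.exp_pos (t / τp))
    nlinarith
  obtain ⟨T, hT⟩ : ∃ T, T = max T₀ 0 := ⟨_, rfl⟩
  rw [← hT] at hCb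
  have hXd : ∀ t, HasDerivAt (fun t => X t - m / 2 * t) (C t - m / 2) t := by
    intro t
    exact ((hX t).sub ((hasDerivAt_id t).const_mul (m / 2))).congr_deriv (by ring)
  have hXm : MonotoneOn (fun t => X t - m / 2 * t) (Set.Ici T) := by
    refine monotoneOn_of_deriv_nonneg (convex_Ici T)
      (fun t _ => (hXd t).continuousAt.continuousWithinAt)
      (fun t _ => (hXd t).differentiableAt.differentiableWithinAt) (fun t ht => ?_)
    rw [(hXd t).deriv]
    have := hCb t (interior_subset ht)
    linarith
  have hXb : ∀ t, T ≤ t → X T + m / 2 * (t - T) ≤ X t := by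
    intro t ht
    have := hXm (Set.mem_Ici.2 le_rfl) (Set.mem_Ici.2 ht) ht
    simp only at this
    linarith
  refine ⟨⟨T, fun t ht => ⟨hCb t ht, by linarith, hXb t ht⟩⟩, ?_⟩
  refine tendsto_atTop_mono' atTop (eventually_atTop.2 ⟨T, hXb⟩) ?_
  refine tendsto_atTop_add_const_left _ _ ?_
  exact (tendsto_atTop_add_const_right _ (-T) tendsto_id).const_mul_atTop (by linarith)
end

section
/- Let X, C : ℝ → ℝ be differentiable functions satisfying, for all t, X'(t) = C(t) and C'(t) = (a'·sin(2πX(t)) + ω − C(t))/τ_p, where a', ω ∈ ℝ and τ_p > 0. If ω > |a'|, then for every ε > 0 there exists a time T such that for all t ≥ T: X(T) + (ω − |a'| − ε)·(t − T) ≤ X(t) ≤ X(T) + (ω + |a'| + ε)·(t − T); that is, the position is eventually sandwiched between two linear signals of slopes approaching ω − |a'| and ω + |a'|, so the particle follows an increasing signal with drift close to ω. -/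
open Real

lemma relax_upper (f f' : ℝ → ℝ) (M τ : ℝ) (hτ : 0 < τ)
    (hf : ∀ t, HasDerivAt f (f' t) t) (hle : ∀ t, f' t ≤ (M - f t) / τ) (ε : ℝ) (hε : 0 < ε) :
    ∃ T : ℝ, ∀ t, T ≤ t → f t ≤ M + ε := by
  have hd : ∀ t, HasDerivAt (fun t => (f t - M) * Real.exp (t / τ))
      (f' t * Real.exp (t / τ) + (f t - M) * (Real.exp (t / τ) * (1 / τ))) t := fun t =>
    ((hf t).sub_const M).mul ((hasDerivAt_id t).div_const τ).exp
  have hanti : Antitone (fun t => (f t - M) * Real.exp (t / τ)) := by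
    refine antitone_of_hasDerivAt_nonpos hd fun t => ?_
    have h1 : f' t * Real.exp (t / τ) + (f t - M) * (Real.exp (t / τ) * (1 / τ))
        = (f' t - (M - f t) / τ) * Real.exp (t / τ) := by
      field_simp
      ring
    rw [h1]
    exact mul_nonpos_of_nonpos_of_nonneg (by linarith [hle t]) (Real.exp_pos _).le
  have hlim : Filter.Tendsto (fun t : ℝ => ε * Real.exp (t / τ)) Filter.atTop Filter.atTop :=
    (Real.tendsto_exp_atTop.comp (Filter.tendsto_id.atTop_div_const hτ)).const_mul_atTop hε
  obtain ⟨T, hT⟩ := Filter.eventually_atTop.1 (hlim.eventually_ge_atTop (f 0 - M))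
  refine ⟨max T 0, fun t ht => ?_⟩
  have h1 := hT t ((le_max_left _ _).trans ht)
  have h2 := hanti ((le_max_right _ _).trans ht)
  simp only [zero_div, Real.exp_zero, mul_one] at h2
  have h3 := le_of_mul_le_mul_right (h2.trans h1) (Real.exp_pos _)
  linarith

/-- If `ω > |a'|`, the position of the reduced 1D particle system is eventually sandwiched
between two linear signals of slopes approaching `ω − |a'|` and `ω + |a'|`: the particle
follows an increasing signal with drift close to `ω`. -/
theorem stmt_5 (X C : ℝ → ℝ) (a' ω τp : ℝ) (hτ : 0 < τp)
    (hX : ∀ t, HasDerivAt X (C t) t)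
    (hC : ∀ t, HasDerivAt C ((a' * Real.sin (2 * Real.pi * X t) + ω - C t) / τp) t)
    (hω : |a'| < ω) :
    ∀ ε > 0, ∃ T : ℝ, ∀ t, T ≤ t →
      X T + (ω - |a'| - ε) * (t - T) ≤ X t ∧
      X t ≤ X T + (ω + |a'| + ε) * (t - T) := by
  intro ε hε
  have hb : ∀ t, |a' * Real.sin (2 * Real.pi * X t)| ≤ |a'| := fun t => by
    rw [abs_mul]
    exact mul_le_of_le_one_right (abs_nonneg _) (Real.abs_sin_le_one _)
  obtain ⟨T1, h1⟩ := relax_upper C _ (ω + |a'|) τp hτ hC (fun t => by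
    have := (abs_le.1 (hb t)).2
    gcongr ?_ / _
    linarith) ε hε
  obtain ⟨T2, h2⟩ := relax_upper (fun t => - C t) _ (-(ω - |a'|)) τp hτ (fun t => (hC t).neg)
    (fun t => by
      have := (abs_le.1 (hb t)).1
      rw [← neg_div]
      gcongr ?_ / _
      linarith) ε hε
  refine ⟨max T1 T2, fun t ht => ?_⟩
  have hdiff : Differentiable ℝ X := fun t => (hX t).differentiableAt
  have hmem : ∀ x ∈ interior (Set.Ici (max T1 T2)), max T1 T2 ≤ x := fun x hx =>
    interior_subset hx
  constructor
  · have := (convex_Ici (max T1 T2)).mul_sub_le_image_sub_of_le_deriv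
      hdiff.continuous.continuousOn hdiff.differentiableOn (C := ω - |a'| - ε)
      (fun x hx => by
        rw [(hX x).deriv]
        have := h2 x ((le_max_right _ _).trans (hmem x hx))
        linarith) _ Set.self_mem_Ici t ht ht
    linarith
  · have := (convex_Ici (max T1 T2)).image_sub_le_mul_sub_of_deriv_le
      hdiff.continuous.continuousOn hdiff.differentiableOn (C := ω + |a'| + ε)
      (fun x hx => by
        rw [(hX x).deriv]
        have := h1 x ((le_max_left _ _).trans (hmem x hx))
        linarith) _ Set.self_mem_Ici t ht ht
    linarith
end

section
/- Let X, C : ℝ → ℝ be differentiable functions satisfying, for all t, X'(t) = C(t) and C'(t) = (a'·sin(2πX(t)) + ω − C(t))/τ_p, where τ_p > 0, a' ≠ 0 and ω > |a'|. Then the velocity C(t) does not converge to any limit as t → +∞; equivalently, the relative velocity V(t) = C(t) − ω cannot converge to a constant V̄. -/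
open Real Filter

/-- Under `τ_p > 0`, `a' ≠ 0` and `ω > |a'|`, the velocity of the reduced 1D particle system
does not converge to any limit as `t → +∞`; equivalently the relative velocity
`V(t) = C(t) − ω` cannot converge to a constant. -/
theorem stmt_7 (X C : ℝ → ℝ) (a' ω τp : ℝ) (hτ : 0 < τp) (ha : a' ≠ 0)
    (hω : |a'| < ω)
    (hX : ∀ t, HasDerivAt X (C t) t)
    (hC : ∀ t, HasDerivAt C ((a' * Real.sin (2 * Real.pi * X t) + ω - C t) / τp) t) :
    ¬ ∃ L : ℝ, Tendsto C atTop (nhds L) := by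
  rintro ⟨L, hL⟩
  have hA : 0 < |a'| := abs_pos.mpr ha
  have hpi := Real.pi_pos
  have hXc : Continuous X := continuous_iff_continuousAt.mpr fun t => (hX t).continuousAt
  have hCc : Continuous C := continuous_iff_continuousAt.mpr fun t => (hC t).continuousAt
  have hB : 0 < |L| + 1 := by positivity
  obtain ⟨h, hh, hhe⟩ : ∃ h : ℝ, 0 < h ∧ 2 * π * ((|L| + 1) * h) = 1 / 4 :=
    ⟨1 / (8 * π * (|L| + 1)), by positivity, by field_simp; norm_num⟩
  obtain ⟨ε, hε, hε1, hεb⟩ : ∃ ε : ℝ, 0 < ε ∧ ε ≤ 1 ∧ (2 * τp / h + 1) * ε ≤ |a'| / 4 := by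
    have hk : 0 < 2 * τp / h + 1 := by positivity
    refine ⟨min 1 (|a'| / 4 / (2 * τp / h + 1)), by positivity, min_le_left _ _, ?_⟩
    calc _ ≤ (2 * τp / h + 1) * (|a'| / 4 / (2 * τp / h + 1)) := by
          gcongr; exact min_le_right _ _
      _ = _ := by field_simp
  obtain ⟨T, hT⟩ := (Metric.tendsto_atTop.mp hL) ε hε
  have hT' : ∀ t, T ≤ t → |C t - L| < ε := fun t ht => by
    simpa [Real.dist_eq] using hT t ht
  have hCb : ∀ t, T ≤ t → |C t| ≤ |L| + 1 := fun t ht => by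
    have h1 := hT' t ht
    have h2 := abs_sub_abs_le_abs_sub (C t) L
    linarith
  -- key estimate
  have key : ∀ t, T ≤ t → |a' * sin (2 * π * X t) - (L - ω)| < |a'| := by
    intro t ht
    obtain ⟨ξ, hξ, he⟩ := exists_hasDerivAt_eq_slope C _ (show t < t + h by linarith)
      hCc.continuousOn (fun x _ => hC x)
    have hTξ : T ≤ ξ := by linarith [hξ.1]
    have hx : |X ξ - X t| ≤ (|L| + 1) * h := by
      obtain ⟨η, hη, he2⟩ := exists_hasDerivAt_eq_slope X _ hξ.1
        hXc.continuousOn (fun x _ => hX x)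
      have hp : 0 < ξ - t := by linarith [hξ.1]
      have : X ξ - X t = C η * (ξ - t) := by rw [he2]; field_simp
      rw [this, abs_mul, abs_of_pos hp]
      have := hCb η (by linarith [hη.1])
      have h2 : ξ - t ≤ h := by linarith [hξ.2]
      gcongr
    have hs : |sin (2 * π * X t) - sin (2 * π * X ξ)| ≤ 1 / 4 := by
      have h1 : |sin (2 * π * X t) - sin (2 * π * X ξ)| ≤ |2 * π * X t - 2 * π * X ξ| := by
        have := Real.lipschitzWith_sin.dist_le_mul (2 * π * X t) (2 * π * X ξ)
        simpa [Real.dist_eq] using this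
      have h2 : |2 * π * X t - 2 * π * X ξ| = 2 * π * |X ξ - X t| := by
        rw [← mul_sub, abs_mul, abs_of_pos (by positivity), abs_sub_comm]
      rw [h2] at h1
      have : 2 * π * |X ξ - X t| ≤ 2 * π * ((|L| + 1) * h) := by gcongr
      linarith
    have hs2 : |a' * (sin (2 * π * X t) - sin (2 * π * X ξ))| ≤ |a'| / 4 := by
      rw [abs_mul]
      nlinarith
    have e1 : a' * sin (2 * π * X ξ) + ω - C ξ = τp / h * (C (t + h) - C t) := by
      rw [add_sub_cancel_left] at he
      field_simp at he ⊢
      linarith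
    have h3 : |C (t + h) - C t| ≤ 2 * ε := by
      have a1 := abs_lt.mp (hT' t ht)
      have a2 := abs_lt.mp (hT' (t + h) (by linarith))
      rw [abs_le]; constructor <;> linarith [a1.1, a1.2, a2.1, a2.2]
    have h4 : |τp / h * (C (t + h) - C t)| ≤ τp / h * (2 * ε) := by
      rw [abs_mul, abs_of_pos (by positivity : 0 < τp / h)]
      gcongr
    have h5 : τp / h * (2 * ε) + ε ≤ |a'| / 4 := by
      calc _ = (2 * τp / h + 1) * ε := by ring
        _ ≤ _ := hεb
    rw [← e1] at h4
    have b1 := abs_le.mp h4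
    have b2 := abs_le.mp hs2
    have b3 := abs_lt.mp (hT' ξ hTξ)
    rw [abs_lt]
    constructor <;> linarith [b1.1, b1.2, b2.1, b2.2, b3.1, b3.2]
  -- growth of X
  have grow : ∀ t, T ≤ t →
      (ω - |a'|) * (t - T) ≤ (τp * C t + X t) - (τp * C T + X T) := by
    intro t ht
    have hF : ∀ s, HasDerivAt (fun s => τp * C s + X s) (a' * sin (2 * π * X s) + ω) s := by
      intro s
      have e : a' * sin (2 * π * X s) + ω
          = τp * ((a' * sin (2 * π * X s) + ω - C s) / τp) + C s := by
        rw [mul_div_cancel₀ _ hτ.ne']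
        ring
      rw [e]
      exact ((hC s).const_mul τp).add (hX s)
    rcases ht.eq_or_lt with rfl | ht
    · simp
    obtain ⟨ξ, hξ, he⟩ := exists_hasDerivAt_eq_slope (fun s => τp * C s + X s) _ ht
      (by fun_prop) (fun x _ => hF x)
    have hp : 0 < t - T := by linarith
    rw [eq_div_iff hp.ne'] at he
    have : |a' * sin (2 * π * X ξ)| ≤ |a'| := by
      rw [abs_mul]
      have := Real.abs_sin_le_one (2 * π * X ξ)
      nlinarith
    have := (abs_le.mp this).1
    rw [← he]
    gcongr
    linarith
  have hit : ∀ y, X T ≤ y → ∃ t, T ≤ t ∧ X t = y := by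
    intro y hy
    have hd : 0 < ω - |a'| := by linarith
    have hc : 0 ≤ (y - X T + 2 * τp * (|L| + 1)) / (ω - |a'|) := by
      apply div_nonneg _ hd.le
      have : 0 < 2 * τp * (|L| + 1) := by positivity
      linarith
    set s := T + (y - X T + 2 * τp * (|L| + 1)) / (ω - |a'|) with hs
    have hTs : T ≤ s := by linarith
    have g := grow s hTs
    have e : (ω - |a'|) * (s - T) = y - X T + 2 * τp * (|L| + 1) := by
      rw [hs]; field_simp; ring
    have c1 := mul_le_mul_of_nonneg_left (abs_le.mp (hCb s hTs)).2 hτ.le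
    have c2 := mul_le_mul_of_nonneg_left (abs_le.mp (hCb T le_rfl)).1 hτ.le
    have hys : y ≤ X s := by linarith
    obtain ⟨t, ht, rfl⟩ := intermediate_value_Icc hTs hXc.continuousOn ⟨hy, hys⟩
    exact ⟨t, ht.1, rfl⟩
  obtain ⟨n, hn⟩ := exists_nat_ge (X T)
  obtain ⟨t1, ht1, hx1⟩ := hit (n + 1 / 4) (by linarith)
  obtain ⟨t2, ht2, hx2⟩ := hit (n + 3 / 4) (by linarith)
  have s1 : sin (2 * π * X t1) = 1 := by
    rw [hx1, show 2 * π * ((n : ℝ) + 1 / 4) = π / 2 + n * (2 * π) by ring,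
      Real.sin_add_nat_mul_two_pi, Real.sin_pi_div_two]
  have s2 : sin (2 * π * X t2) = -1 := by
    rw [hx2, show 2 * π * ((n : ℝ) + 3 / 4) = (π / 2 + π) + n * (2 * π) by ring,
      Real.sin_add_nat_mul_two_pi, Real.sin_add_pi, Real.sin_pi_div_two]
  have k1 := key t1 ht1
  have k2 := key t2 ht2
  rw [s1] at k1
  rw [s2] at k2
  have k1' := abs_lt.mp k1
  have k2' := abs_lt.mp k2
  rcases abs_cases a' with ⟨e, _⟩ | ⟨e, _⟩ <;> rw [e] at k1' k2' <;>
    linarith [k1'.1, k1'.2, k2'.1, k2'.2]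
end

section
/- Let X, C : ℝ → ℝ be differentiable functions satisfying, for all t, X'(t) = C(t) and C'(t) = (a'·sin(2πX(t)) + ω − C(t))/τ_p, where τ_p > 0, a' ≠ 0 and ω > |a'|. Then the velocity C is not eventually monotone: there is no time T such that C is monotone nondecreasing on [T, ∞), and no time T such that C is monotone nonincreasing on [T, ∞). Consequently the derivative of C changes sign at arbitrarily large times. -/
open Real Filter

lemma aux_sin_hit (a B : ℝ) : ∃ y, B ≤ y ∧ a * Real.sin (2 * Real.pi * y) = |a| := by
  obtain ⟨n, hn⟩ := exists_nat_ge (B + 1)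
  rcases le_total 0 a with h | h
  · refine ⟨n + 1/4, by linarith, ?_⟩
    have : 2 * Real.pi * ((n:ℝ) + 1/4) = Real.pi / 2 + n * (2 * Real.pi) := by ring
    rw [this, Real.sin_add_nat_mul_two_pi, Real.sin_pi_div_two, abs_of_nonneg h, mul_one]
  · refine ⟨n - 1/4, by linarith, ?_⟩
    have : 2 * Real.pi * ((n:ℝ) - 1/4) = -(Real.pi / 2) + n * (2 * Real.pi) := by ring
    rw [this, Real.sin_add_nat_mul_two_pi, Real.sin_neg, Real.sin_pi_div_two, abs_of_nonpos h]
    ring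

lemma aux_mono (f f' : ℝ → ℝ) (T : ℝ) (hf : ∀ t, HasDerivAt f (f' t) t)
    (h : ∀ t, T ≤ t → 0 ≤ f' t) : MonotoneOn f (Set.Ici T) := by
  apply monotoneOn_of_deriv_nonneg (convex_Ici T)
  · exact fun t _ => (hf t).continuousAt.continuousWithinAt
  · exact fun t _ => (hf t).differentiableAt.differentiableWithinAt
  · intro t ht
    rw [(hf t).deriv]
    exact h t (interior_subset ht)

lemma aux_anti (f f' : ℝ → ℝ) (T : ℝ) (hf : ∀ t, HasDerivAt f (f' t) t)
    (h : ∀ t, T ≤ t → f' t ≤ 0) : AntitoneOn f (Set.Ici T) := by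
  have := aux_mono (fun t => - f t) (fun t => - f' t) T (fun t => (hf t).neg)
    (fun t ht => by linarith [h t ht])
  intro x hx y hy hxy
  have := this hx hy hxy
  simp only at this
  linarith

lemma aux_deriv_nonneg (f f' : ℝ → ℝ) (T : ℝ) (hf : ∀ t, HasDerivAt f (f' t) t)
    (h : MonotoneOn f (Set.Ici T)) (t : ℝ) (ht : T ≤ t) : 0 ≤ f' t := by
  have h1 := (hf t).hasDerivWithinAt (s := Set.Ici T)
  rw [← h1.derivWithin (uniqueDiffOn_Ici T t ht)]
  exact h.derivWithin_nonneg

lemma aux_deriv_nonpos (f f' : ℝ → ℝ) (T : ℝ) (hf : ∀ t, HasDerivAt f (f' t) t)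
    (h : AntitoneOn f (Set.Ici T)) (t : ℝ) (ht : T ≤ t) : f' t ≤ 0 := by
  have h1 := (hf t).hasDerivWithinAt (s := Set.Ici T)
  rw [← h1.derivWithin (uniqueDiffOn_Ici T t ht)]
  exact h.derivWithin_nonpos

lemma aux_unbdd (f f' : ℝ → ℝ) (T c : ℝ) (hc : 0 < c) (hf : ∀ t, HasDerivAt f (f' t) t)
    (h : ∀ t, T ≤ t → c ≤ f' t) (B : ℝ) : ∃ t, T ≤ t ∧ B ≤ f t := by
  have hm := aux_mono (fun t => f t - c * t) (fun t => f' t - c * 1) T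
    (fun t => (hf t).sub ((hasDerivAt_id t).const_mul c)) (fun t ht => by linarith [h t ht])
  have hs : T ≤ T + |B - f T| / c := by
    have : 0 ≤ |B - f T| / c := by positivity
    linarith
  refine ⟨_, hs, ?_⟩
  have h2 := hm (Set.mem_Ici.2 le_rfl) (Set.mem_Ici.2 hs) hs
  simp only at h2
  have h3 : c * (T + |B - f T| / c) = c * T + |B - f T| := by field_simp
  rw [h3] at h2
  linarith [le_abs_self (B - f T)]

lemma aux_hit (f f' : ℝ → ℝ) (T c : ℝ) (hc : 0 < c) (hf : ∀ t, HasDerivAt f (f' t) t)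
    (h : ∀ t, T ≤ t → c ≤ f' t) (S : ℝ) (hS : T ≤ S) (a : ℝ) :
    ∃ t, S ≤ t ∧ a * Real.sin (2 * Real.pi * f t) = |a| := by
  obtain ⟨y, hy, hya⟩ := aux_sin_hit a (f S)
  obtain ⟨t, ht, hty⟩ := aux_unbdd f f' S c hc hf (fun t ht => h t (hS.trans ht)) y
  obtain ⟨u, hu, huy⟩ := intermediate_value_Icc ht
    (fun t _ => (hf t).continuousAt.continuousWithinAt) (Set.mem_Icc.2 ⟨hy, hty⟩)
  exact ⟨u, hu.1, by rw [huy, hya]⟩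

lemma aux_abs (a x : ℝ) : -|a| ≤ a * Real.sin x ∧ a * Real.sin x ≤ |a| := by
  rw [← abs_le, abs_mul]
  exact mul_le_of_le_one_right (abs_nonneg a) (Real.abs_sin_le_one x)

lemma aux_F (X C D : ℝ → ℝ) (k l m : ℝ)
    (hX : ∀ t, HasDerivAt X (C t) t) (hC : ∀ t, HasDerivAt C (D t) t) (t : ℝ) :
    HasDerivAt (fun t => k * C t + (l * X t + m * (Real.cos (2 * Real.pi * X t) / (2 * Real.pi))))
      (k * D t + (l - m * Real.sin (2 * Real.pi * X t)) * C t) t := by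
  have h1 := (((hX t).const_mul (2 * Real.pi)).cos.div_const (2 * Real.pi)).const_mul m
  have h2 := ((hC t).const_mul k).add (((hX t).const_mul l).add h1)
  refine h2.congr_deriv ?_
  have := Real.pi_pos.ne'
  field_simp
  ring

lemma aux_cos (m x : ℝ) : |m * (Real.cos x / (2 * Real.pi))| ≤ |m| := by
  rw [abs_mul]
  apply mul_le_of_le_one_right (abs_nonneg m)
  rw [abs_div, abs_of_pos Real.two_pi_pos, div_le_one Real.two_pi_pos]
  linarith [Real.abs_cos_le_one x, Real.two_le_pi]

lemma aux_not_mono (X C : ℝ → ℝ) (a' ω τp : ℝ) (hτ : 0 < τp) (ha : a' ≠ 0)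
    (hω : |a'| < ω)
    (hX : ∀ t, HasDerivAt X (C t) t)
    (hC : ∀ t, HasDerivAt C ((a' * Real.sin (2 * Real.pi * X t) + ω - C t) / τp) t)
    (T : ℝ) (hm : MonotoneOn C (Set.Ici T)) : False := by
  have ha0 : 0 < |a'| := abs_pos.2 ha
  -- a positive lower bound for C at some time
  have h1 : ∃ t, T ≤ t ∧ (ω - |a'|) / 2 ≤ C t := by
    by_contra! hcon
    obtain ⟨t, ht, h⟩ := aux_unbdd C _ T ((ω - |a'|) / 2 / τp)
      (by apply div_pos _ hτ; linarith) hC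
      (fun t ht => by
        apply div_le_div_of_nonneg_right _ hτ.le
        linarith [hcon t ht, (aux_abs a' (2 * Real.pi * X t)).1]) ((ω - |a'|) / 2)
    linarith [hcon t ht]
  obtain ⟨S, hTS, hS⟩ := h1
  have hlow : ∀ t, S ≤ t → (ω - |a'|) / 2 ≤ C t := fun t ht =>
    hS.trans (hm hTS (Set.mem_Ici.2 (hTS.trans ht)) ht)
  have hpos : 0 < (ω - |a'|) / 2 := by linarith
  have hup : ∀ t, S ≤ t → C t ≤ ω - |a'| := by
    intro t ht
    obtain ⟨u, hu, hua⟩ := aux_hit X C S _ hpos hX hlow t ht (-a')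
    have hd := aux_deriv_nonneg C _ T hC hm u (hTS.trans (ht.trans hu))
    have hd' := mul_nonneg hd hτ.le
    rw [div_mul_cancel₀ _ hτ.ne'] at hd'
    rw [abs_neg] at hua
    have := hm (Set.mem_Ici.2 (hTS.trans ht)) (Set.mem_Ici.2 (hTS.trans (ht.trans hu))) hu
    linarith
  have hF := aux_mono _ _ S (aux_F X C _ ((ω - |a'|) * τp) (-|a'|) a' hX hC) (by
    intro t ht
    have e : (ω - |a'|) * τp * ((a' * Real.sin (2 * Real.pi * X t) + ω - C t) / τp)
      = (ω - |a'|) * (a' * Real.sin (2 * Real.pi * X t) + ω - C t) := by field_simp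
    rw [e]
    have b1 := (aux_abs a' (2 * Real.pi * X t)).1
    have b2 := hup t ht
    nlinarith [mul_nonneg (sub_nonneg.2 b1) (sub_nonneg.2 b2),
      mul_nonneg hpos.le (sub_nonneg.2 b2)])
  set K := (ω - |a'|) * τp with hK
  have hK0 : 0 ≤ K := by have : 0 < ω - |a'| := by linarith
                         positivity
  obtain ⟨t, ht, hB⟩ := aux_unbdd X C S _ hpos hX hlow
    ((K * (ω - |a'|) + |a'| - (K * C S + (-|a'| * X S +
      a' * (Real.cos (2 * Real.pi * X S) / (2 * Real.pi)))) + 1) / |a'|)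
  rw [div_le_iff₀ ha0] at hB
  have h2 := hF (Set.mem_Ici.2 le_rfl) (Set.mem_Ici.2 ht) ht
  simp only at h2
  have h3 := le_of_abs_le (aux_cos a' (2 * Real.pi * X t))
  have h4 := mul_le_mul_of_nonneg_left (hup t ht) hK0
  linarith

lemma aux_not_anti (X C : ℝ → ℝ) (a' ω τp : ℝ) (hτ : 0 < τp) (ha : a' ≠ 0)
    (hω : |a'| < ω)
    (hX : ∀ t, HasDerivAt X (C t) t)
    (hC : ∀ t, HasDerivAt C ((a' * Real.sin (2 * Real.pi * X t) + ω - C t) / τp) t)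
    (T : ℝ) (hm : AntitoneOn C (Set.Ici T)) : False := by
  have ha0 : 0 < |a'| := abs_pos.2 ha
  have hd : ∀ t, T ≤ t → a' * Real.sin (2 * Real.pi * X t) + ω ≤ C t := by
    intro t ht
    have hd := aux_deriv_nonpos C _ T hC hm t ht
    have hd' := mul_nonneg (neg_nonneg.2 hd) hτ.le
    rw [neg_mul, div_mul_cancel₀ _ hτ.ne'] at hd'
    linarith
  have hlow : ∀ t, T ≤ t → ω - |a'| ≤ C t := fun t ht => by
    linarith [hd t ht, (aux_abs a' (2 * Real.pi * X t)).1]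
  have hpos : 0 < ω - |a'| := by linarith
  have hlow2 : ∀ t, T ≤ t → ω + |a'| ≤ C t := by
    intro t ht
    obtain ⟨u, hu, hua⟩ := aux_hit X C T _ hpos hX hlow t ht a'
    have := hm (Set.mem_Ici.2 ht) (Set.mem_Ici.2 (ht.trans hu)) hu
    linarith [hd u (ht.trans hu)]
  have hM : 0 < C T := by linarith [hlow T le_rfl]
  have hF := aux_anti _ _ T (aux_F X C _ (C T * τp) (|a'|) a' hX hC) (by
    intro t ht
    have e : C T * τp * ((a' * Real.sin (2 * Real.pi * X t) + ω - C t) / τp)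
      = C T * (a' * Real.sin (2 * Real.pi * X t) + ω - C t) := by field_simp
    rw [e]
    have b1 := (aux_abs a' (2 * Real.pi * X t)).2
    have b2 := hm (Set.mem_Ici.2 le_rfl) (Set.mem_Ici.2 ht) ht
    have b3 := hlow2 t ht
    nlinarith [mul_nonneg (sub_nonneg.2 b1) (sub_nonneg.2 b2),
      mul_nonneg hM.le (sub_nonneg.2 b3)])
  set K := C T * τp with hK
  have hK0 : 0 ≤ K := by positivity
  obtain ⟨t, ht, hB⟩ := aux_unbdd X C T _ hpos hX hlow
    ((|a'| + (K * C T + (|a'| * X T +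
      a' * (Real.cos (2 * Real.pi * X T) / (2 * Real.pi)))) + 1) / |a'|)
  rw [div_le_iff₀ ha0] at hB
  have h2 := hF (Set.mem_Ici.2 le_rfl) (Set.mem_Ici.2 ht) ht
  simp only at h2
  have h3 := (abs_le.1 (aux_cos a' (2 * Real.pi * X t))).1
  have h4 := mul_nonneg hK0 (hpos.le.trans (hlow t ht))
  linarith

/-- Under `τ_p > 0`, `a' ≠ 0` and `ω > |a'|`, the velocity of the reduced 1D particle system
is not eventually monotone: it is nondecreasing on no ray `[T, ∞)` and nonincreasing on no
ray `[T, ∞)`; consequently its derivative changes sign at arbitrarily large times. -/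
theorem stmt_8 (X C : ℝ → ℝ) (a' ω τp : ℝ) (hτ : 0 < τp) (ha : a' ≠ 0)
    (hω : |a'| < ω)
    (hX : ∀ t, HasDerivAt X (C t) t)
    (hC : ∀ t, HasDerivAt C ((a' * Real.sin (2 * Real.pi * X t) + ω - C t) / τp) t) :
    (¬ ∃ T : ℝ, MonotoneOn C (Set.Ici T)) ∧
    (¬ ∃ T : ℝ, AntitoneOn C (Set.Ici T)) ∧
    (∀ T : ℝ, ∃ t₁, T ≤ t₁ ∧ 0 < deriv C t₁) ∧
    (∀ T : ℝ, ∃ t₂, T ≤ t₂ ∧ deriv C t₂ < 0) := by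
  have hm := aux_not_mono X C a' ω τp hτ ha hω hX hC
  have hn := aux_not_anti X C a' ω τp hτ ha hω hX hC
  refine ⟨fun ⟨T, h⟩ => hm T h, fun ⟨T, h⟩ => hn T h, fun T => ?_, fun T => ?_⟩
  · by_contra! hcon
    exact hn T (aux_anti C _ T hC (fun t ht => by rw [← (hC t).deriv]; exact hcon t ht))
  · by_contra! hcon
    exact hm T (aux_mono C _ T hC (fun t ht => by rw [← (hC t).deriv]; exact hcon t ht))
end
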